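/- There exist absolute constants c, c' > 0 such that the following holds. For every probability measure ν on Σ^n satisfying Assumption A (with parameters q = |Σ|, b, ρ, Δ), every f : Σ^n → ℝ, and every T with 0 < T ≤ c/(b²q²Δ²), we have Var_ν(f) ≤ (c'·q²·b²/(1 − e^{−ρT})) · ∫₀^T Σ_{j=1}^n ‖L_j f‖²_{1+e^{−2ρt}} dt. (Main functional inequality.) -/

import Mathlib

open scoped Classical BigOperators

noncomputable section

abbrev Cfg (σ : Type) (n : ℕ) : Type := Fin n → σ

variable {σ : Type} [Fintype σ] [DecidableEq σ] {n : ℕ}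

/-- Expectation of `f` under the discrete measure `ν`. -/
def expct (ν f : Cfg σ n → ℝ) : ℝ := ∑ x, ν x * f x

/-- Variance of `f` under `ν`. -/
def varnc (ν f : Cfg σ n → ℝ) : ℝ := expct ν (fun x => (f x - expct ν f) ^ 2)

/-- ν is a fully supported probability measure. -/
def IsProb (ν : Cfg σ n → ℝ) : Prop := (∀ x, 0 < ν x) ∧ ∑ x, ν x = 1

/-- `(P_i f)(x) = E[f(X) | X_j = x_j ∀ j ≠ i]`. -/
def Pop (ν : Cfg σ n → ℝ) (i : Fin n) (f : Cfg σ n → ℝ) (x : Cfg σ n) : ℝ :=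
  (∑ y ∈ Finset.univ.filter (fun y : Cfg σ n => ∀ j, j ≠ i → y j = x j), ν y * f y) /
    (∑ y ∈ Finset.univ.filter (fun y : Cfg σ n => ∀ j, j ≠ i → y j = x j), ν y)

/-- `L_i f = P_i f - f`. -/
def Lop (ν : Cfg σ n → ℝ) (i : Fin n) (f : Cfg σ n → ℝ) (x : Cfg σ n) : ℝ :=
  Pop ν i f x - f x

/-- `‖f‖_p = (E_ν |f|^p)^{1/p}`. -/
def pnorm (ν : Cfg σ n → ℝ) (p : ℝ) (f : Cfg σ n → ℝ) : ℝ :=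
  (∑ x, ν x * |f x| ^ p) ^ (1 / p)

/-- Relative-entropy functional `Ent_ν[g]`. -/
def entFun (ν g : Cfg σ n → ℝ) : ℝ :=
  expct ν (fun x => g x * Real.log (g x)) - expct ν g * Real.log (expct ν g)

/-- The log-Sobolev inequality with constant `ρ` for the Glauber dynamics of `ν`. -/
def LogSobolev (ν : Cfg σ n → ℝ) (ρ : ℝ) : Prop :=
  ∀ g : Cfg σ n → ℝ, (∀ x, 0 ≤ g x) →
    ρ * entFun ν g ≤ 2 * ∑ i : Fin n, expct ν (fun x => (Lop ν i (fun y => Real.sqrt (g y)) x) ^ 2)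

/-- `ν` is `b`-marginally bounded. -/
def MargBounded (ν : Cfg σ n → ℝ) (b : ℝ) : Prop :=
  ∀ x y : Cfg σ n, hammingDist x y = 1 → 1 / b ≤ ν x / ν y ∧ ν x / ν y ≤ b

/-- Conditional probability `Pr[X_i = a | X_j = x_j ∀ j ≠ i]`. -/
def condProb (ν : Cfg σ n → ℝ) (i : Fin n) (x : Cfg σ n) (a : σ) : ℝ :=
  ν (Function.update x i a) / ∑ a' : σ, ν (Function.update x i a')

/-- `ν` is a Markov random field w.r.t. `G`: the conditional law of `X_i` given all other
coordinates depends only on the neighbors of `i` in `G`. -/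
def IsMRF (ν : Cfg σ n → ℝ) (G : SimpleGraph (Fin n)) : Prop :=
  ∀ (i : Fin n) (x y : Cfg σ n), (∀ j, G.Adj i j → x j = y j) →
    ∀ a : σ, condProb ν i x a = condProb ν i y a

/-- The graph `G` has maximum degree at most `Δ`. -/
def MaxDegLE {m : ℕ} (G : SimpleGraph (Fin m)) (Δ : ℕ) : Prop :=
  ∀ i, (Finset.univ.filter fun j => G.Adj i j).card ≤ Δ

/-- Assumption A: fully supported probability measure, `b`-marginally bounded,
log-Sobolev with constant `ρ ∈ (0,1]`, and an MRF w.r.t. a graph of max degree `Δ`. -/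
def AssumptionA (ν : Cfg σ n → ℝ) (b ρ : ℝ) (Δ : ℕ) : Prop :=
  IsProb ν ∧ 1 ≤ b ∧ MargBounded ν b ∧ 0 < ρ ∧ ρ ≤ 1 ∧ LogSobolev ν ρ ∧
    ∃ G : SimpleGraph (Fin n), IsMRF ν G ∧ MaxDegLE G Δ

/-- Influence of coordinate `i` on `f`. -/
def influence (ν : Cfg σ n → ℝ) (f : Cfg σ n → ℝ) (i : Fin n) : ℝ :=
  ∑ x ∈ Finset.univ.filter (fun x : Cfg σ n => ∃ a : σ, f (Function.update x i a) ≠ f x), ν x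

set_option linter.unusedSectionVars false

/-- The weighted inner product `E_ν[f g]`. -/
def innerW (ν f g : Cfg σ n → ℝ) : ℝ := ∑ x, ν x * (f x * g x)

/-- The transition kernel of the conditional expectation operator `Pop ν i`. -/
def kern (ν : Cfg σ n → ℝ) (i : Fin n) (x y : Cfg σ n) : ℝ :=
  if (∀ j, j ≠ i → y j = x j) then
    ν y / ∑ z ∈ Finset.univ.filter (fun z : Cfg σ n => ∀ j, j ≠ i → z j = x j), ν z else 0

lemma fiberMass_pos {ν : Cfg σ n → ℝ} (hν : ∀ x, 0 < ν x) (i : Fin n) (x : Cfg σ n) :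
    0 < ∑ z ∈ Finset.univ.filter (fun z : Cfg σ n => ∀ j, j ≠ i → z j = x j), ν z :=
  Finset.sum_pos (fun z _ => hν z) ⟨x, by simp⟩

lemma fiber_eq {i : Fin n} {x y : Cfg σ n} (h : ∀ j, j ≠ i → y j = x j) :
    Finset.univ.filter (fun z : Cfg σ n => ∀ j, j ≠ i → z j = y j) =
      Finset.univ.filter (fun z : Cfg σ n => ∀ j, j ≠ i → z j = x j) := by
  ext z
  simp only [Finset.mem_filter, Finset.mem_univ, true_and]
  exact ⟨fun hz j hj => (hz j hj).trans (h j hj), fun hz j hj => (hz j hj).trans (h j hj).symm⟩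

lemma Pop_eq_sum_kern (ν f : Cfg σ n → ℝ) (i : Fin n) (x : Cfg σ n) :
    Pop ν i f x = ∑ y, kern ν i x y * f y := by
  unfold Pop kern
  rw [Finset.sum_div, Finset.sum_filter]
  refine Finset.sum_congr rfl fun y _ => ?_
  split_ifs <;> ring

lemma kern_nonneg {ν : Cfg σ n → ℝ} (hν : ∀ x, 0 < ν x) (i : Fin n) (x y : Cfg σ n) :
    0 ≤ kern ν i x y := by
  unfold kern
  split_ifs
  · exact div_nonneg (hν y).le (fiberMass_pos hν i x).le
  · exact le_rfl

lemma sum_kern {ν : Cfg σ n → ℝ} (hν : ∀ x, 0 < ν x) (i : Fin n) (x : Cfg σ n) :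
    ∑ y, kern ν i x y = 1 := by
  unfold kern
  rw [← Finset.sum_filter, ← Finset.sum_div]
  exact div_self (fiberMass_pos hν i x).ne'

lemma kern_reversible (ν : Cfg σ n → ℝ) (i : Fin n) (x y : Cfg σ n) :
    ν x * kern ν i x y = ν y * kern ν i y x := by
  unfold kern
  by_cases h : ∀ j, j ≠ i → y j = x j
  · have h' : ∀ j, j ≠ i → x j = y j := fun j hj => (h j hj).symm
    rw [if_pos h, if_pos h', fiber_eq h]
    ring
  · have h' : ¬ ∀ j, j ≠ i → x j = y j := fun h' => h fun j hj => (h' j hj).symm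
    rw [if_neg h, if_neg h']
    ring

/-- `Pop ν i` as a linear map. -/
def PopLin (ν : Cfg σ n → ℝ) (i : Fin n) : (Cfg σ n → ℝ) →ₗ[ℝ] (Cfg σ n → ℝ) where
  toFun f := Pop ν i f
  map_add' f g := by
    ext x
    simp only [Pop_eq_sum_kern, Pi.add_apply, mul_add, Finset.sum_add_distrib]
  map_smul' c f := by
    ext x
    simp only [Pop_eq_sum_kern, Pi.smul_apply, smul_eq_mul, RingHom.id_apply, Finset.mul_sum]
    exact Finset.sum_congr rfl fun y _ => by ring

/-- `Lop ν i` as a linear map. -/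
def LopLin (ν : Cfg σ n → ℝ) (i : Fin n) : (Cfg σ n → ℝ) →ₗ[ℝ] (Cfg σ n → ℝ) :=
  PopLin ν i - LinearMap.id

lemma PopLin_apply (ν f : Cfg σ n → ℝ) (i : Fin n) : PopLin ν i f = Pop ν i f := rfl

lemma LopLin_apply (ν f : Cfg σ n → ℝ) (i : Fin n) : LopLin ν i f = Lop ν i f := rfl

lemma PopLin_idem {ν : Cfg σ n → ℝ} (hν : ∀ x, 0 < ν x) (i : Fin n) (f : Cfg σ n → ℝ) :
    PopLin ν i (PopLin ν i f) = PopLin ν i f := by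
  ext x
  have h : ∀ y, kern ν i x y * Pop ν i f y = kern ν i x y * Pop ν i f x := by
    intro y
    by_cases h : ∀ j, j ≠ i → y j = x j
    · simp only [Pop, fiber_eq h]
    · simp only [kern, if_neg h, zero_mul]
  rw [PopLin_apply, PopLin_apply, Pop_eq_sum_kern, Finset.sum_congr rfl fun y _ => h y,
    ← Finset.sum_mul, sum_kern hν, one_mul]

lemma LopLin_LopLin {ν : Cfg σ n → ℝ} (hν : ∀ x, 0 < ν x) (i : Fin n) (f : Cfg σ n → ℝ) :
    LopLin ν i (LopLin ν i f) = -LopLin ν i f := by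
  simp only [LopLin, LinearMap.sub_apply, LinearMap.id_apply, map_sub, PopLin_idem hν]
  abel

lemma innerW_comm (ν f g : Cfg σ n → ℝ) : innerW ν f g = innerW ν g f :=
  Finset.sum_congr rfl fun x _ => by ring

lemma innerW_add_right (ν f g h : Cfg σ n → ℝ) :
    innerW ν f (g + h) = innerW ν f g + innerW ν f h := by
  simp only [innerW, Pi.add_apply, mul_add, Finset.sum_add_distrib]

lemma innerW_neg_right (ν f g : Cfg σ n → ℝ) : innerW ν f (-g) = -innerW ν f g := by
  simp only [innerW, Pi.neg_apply, mul_neg, Finset.sum_neg_distrib]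

lemma innerW_sum_right {ι : Type*} (ν f : Cfg σ n → ℝ) (s : Finset ι) (g : ι → Cfg σ n → ℝ) :
    innerW ν f (∑ i ∈ s, g i) = ∑ i ∈ s, innerW ν f (g i) := by
  simp only [innerW, Finset.sum_apply, Finset.mul_sum]
  exact Finset.sum_comm

lemma innerW_self_nonneg {ν : Cfg σ n → ℝ} (hν : ∀ x, 0 < ν x) (f : Cfg σ n → ℝ) :
    0 ≤ innerW ν f f :=
  Finset.sum_nonneg fun x _ => mul_nonneg (hν x).le (mul_self_nonneg _)

/-- The Dirichlet form of `Lop ν i` as a double sum of increments. -/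
lemma innerW_LopLin {ν : Cfg σ n → ℝ} (hν : ∀ x, 0 < ν x) (i : Fin n) (f g : Cfg σ n → ℝ) :
    innerW ν f (LopLin ν i g) =
      -(1 / 2) * ∑ x, ∑ y, ν x * kern ν i x y * ((f x - f y) * (g x - g y)) := by
  have h1 : innerW ν f (LopLin ν i g) =
      ∑ x, ∑ y, ν x * kern ν i x y * (f x * (g y - g x)) := by
    unfold innerW
    refine Finset.sum_congr rfl fun x _ => ?_
    have : LopLin ν i g x = ∑ y, kern ν i x y * (g y - g x) := by
      rw [LopLin_apply, Lop, Pop_eq_sum_kern]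
      simp only [mul_sub, Finset.sum_sub_distrib, ← Finset.sum_mul, sum_kern hν, one_mul]
    rw [this, Finset.mul_sum, Finset.mul_sum]
    exact Finset.sum_congr rfl fun y _ => by ring
  have h2 : innerW ν f (LopLin ν i g) =
      ∑ x, ∑ y, ν x * kern ν i x y * (f y * (g x - g y)) := by
    rw [h1, Finset.sum_comm]
    refine Finset.sum_congr rfl fun y _ => Finset.sum_congr rfl fun x _ => ?_
    rw [kern_reversible]
  have h3 : ∑ x, ∑ y, ν x * kern ν i x y * ((f x - f y) * (g x - g y)) =
      -(∑ x, ∑ y, ν x * kern ν i x y * (f x * (g y - g x))) -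
        ∑ x, ∑ y, ν x * kern ν i x y * (f y * (g x - g y)) := by
    rw [← Finset.sum_neg_distrib, ← Finset.sum_sub_distrib]
    refine Finset.sum_congr rfl fun x _ => ?_
    rw [← Finset.sum_neg_distrib, ← Finset.sum_sub_distrib]
    exact Finset.sum_congr rfl fun y _ => by ring
  rw [h3, ← h1, ← h2]
  ring

lemma LopLin_selfAdjoint {ν : Cfg σ n → ℝ} (hν : ∀ x, 0 < ν x) (i : Fin n)
    (f g : Cfg σ n → ℝ) : innerW ν f (LopLin ν i g) = innerW ν (LopLin ν i f) g := by
  rw [innerW_comm ν (LopLin ν i f) g, innerW_LopLin hν, innerW_LopLin hν]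
  congr 1
  exact Finset.sum_congr rfl fun x _ => Finset.sum_congr rfl fun y _ => by ring

lemma innerW_LopLin_self {ν : Cfg σ n → ℝ} (hν : ∀ x, 0 < ν x) (i : Fin n)
    (f : Cfg σ n → ℝ) :
    innerW ν (LopLin ν i f) (LopLin ν i f) = -innerW ν f (LopLin ν i f) := by
  rw [← LopLin_selfAdjoint hν, LopLin_LopLin hν, innerW_neg_right]

lemma innerW_LopLin_le {ν : Cfg σ n → ℝ} (hν : ∀ x, 0 < ν x) (i : Fin n)
    (f : Cfg σ n → ℝ) :
    innerW ν (LopLin ν i f) (LopLin ν i f) ≤ innerW ν f f := by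
  have h := innerW_self_nonneg hν (f + LopLin ν i f)
  have h2 := innerW_LopLin_self hν i f
  rw [innerW_add_right, innerW_comm ν _ f, innerW_comm ν _ (LopLin ν i f), innerW_add_right,
    innerW_add_right, innerW_comm ν (LopLin ν i f) f] at h
  linarith

lemma Pop_eq_sum_condProb (ν f : Cfg σ n → ℝ) (i : Fin n) (x : Cfg σ n) :
    Pop ν i f x = ∑ a, condProb ν i x a * f (Function.update x i a) := by
  have hfib : Finset.univ.filter (fun z : Cfg σ n => ∀ j, j ≠ i → z j = x j) =
      Finset.univ.image (fun a : σ => Function.update x i a) := by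
    ext z
    simp only [Finset.mem_filter, Finset.mem_univ, true_and, Finset.mem_image]
    constructor
    · intro hz
      refine ⟨z i, ?_⟩
      ext j
      by_cases hj : j = i
      · subst hj; simp
      · simp [hj, hz j hj]
    · rintro ⟨a, rfl⟩ j hj
      simp [hj]
  unfold Pop condProb
  rw [hfib, Finset.sum_image (fun a _ b _ h => Function.update_injective x i h),
    Finset.sum_image (fun a _ b _ h => Function.update_injective x i h), Finset.sum_div]
  exact Finset.sum_congr rfl fun y _ => by ring

lemma PopLin_comm {ν : Cfg σ n → ℝ} {G : SimpleGraph (Fin n)} (hG : IsMRF ν G) {i j : Fin n}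
    (hij : ¬ G.Adj i j) (f : Cfg σ n → ℝ) :
    PopLin ν i (PopLin ν j f) = PopLin ν j (PopLin ν i f) := by
  by_cases h : i = j
  · rw [h]
  ext x
  have key : ∀ {k l : Fin n}, ¬ G.Adj k l → ∀ a b,
      condProb ν k (Function.update x l a) b = condProb ν k x b := fun {k l} hkl a b =>
    hG k _ _ (fun m hm => Function.update_of_ne (by rintro rfl; exact hkl hm) _ _) b
  simp only [PopLin_apply, Pop_eq_sum_condProb, Finset.mul_sum]
  rw [Finset.sum_comm]
  refine Finset.sum_congr rfl fun a _ => Finset.sum_congr rfl fun b _ => ?_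
  rw [key hij, key (fun h' => hij h'.symm), Function.update_comm h]
  ring

lemma innerW_sub_self_le {ν : Cfg σ n → ℝ} (hν : ∀ x, 0 < ν x) (f g : Cfg σ n → ℝ) :
    innerW ν (f - g) (f - g) ≤ 2 * innerW ν f f + 2 * innerW ν g g := by
  simp only [innerW, Finset.mul_sum, ← Finset.sum_add_distrib, Pi.sub_apply]
  refine Finset.sum_le_sum fun x _ => ?_
  nlinarith [mul_nonneg (hν x).le (sq_nonneg (f x + g x))]

lemma innerW_le_young {ν : Cfg σ n → ℝ} (hν : ∀ x, 0 < ν x) {κ : ℝ} (hκ : 0 < κ)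
    (f g : Cfg σ n → ℝ) :
    2 * innerW ν f g ≤ κ * innerW ν f f + κ⁻¹ * innerW ν g g := by
  simp only [innerW, Finset.mul_sum, ← Finset.sum_add_distrib]
  refine Finset.sum_le_sum fun x _ => ?_
  have h : κ * (f x * f x) + κ⁻¹ * (g x * g x) - 2 * (f x * g x) =
      κ * (f x - κ⁻¹ * g x) ^ 2 := by
    field_simp
    ring
  have h2 := mul_nonneg (hν x).le (mul_nonneg hκ.le (sq_nonneg (f x - κ⁻¹ * g x)))
  rw [← h] at h2
  linarith

lemma innerW_sum_self_le {ν : Cfg σ n → ℝ} (hν : ∀ x, 0 < ν x) {ι : Type*} (s : Finset ι)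
    (g : ι → Cfg σ n → ℝ) :
    innerW ν (∑ i ∈ s, g i) (∑ i ∈ s, g i) ≤ s.card * ∑ i ∈ s, innerW ν (g i) (g i) := by
  simp only [innerW, Finset.sum_apply]
  rw [Finset.sum_comm, Finset.mul_sum]
  refine Finset.sum_le_sum fun x _ => ?_
  have := sq_sum_le_card_mul_sum_sq (s := s) (f := fun i => g i x)
  rw [← Finset.mul_sum, ← pow_two, mul_left_comm]
  simp only [← pow_two]
  exact mul_le_mul_of_nonneg_left this (hν x).le

/-- The generator `∑ i, Lop ν i` of the Glauber dynamics. -/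
def genLin (ν : Cfg σ n → ℝ) : (Cfg σ n → ℝ) →ₗ[ℝ] (Cfg σ n → ℝ) := ∑ i, LopLin ν i

/-- The Dirichlet form `∑ i, E[(L_i f)²]`. -/
def dirichlet (ν f : Cfg σ n → ℝ) : ℝ := ∑ i, innerW ν (LopLin ν i f) (LopLin ν i f)

lemma innerW_genLin_self {ν : Cfg σ n → ℝ} (hν : ∀ x, 0 < ν x) (f : Cfg σ n → ℝ) :
    innerW ν f (genLin ν f) = -dirichlet ν f := by
  simp only [genLin, LinearMap.sum_apply, innerW_sum_right, dirichlet, innerW_LopLin_self hν,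
    Finset.sum_neg_distrib, neg_neg]

lemma dirichlet_nonneg {ν : Cfg σ n → ℝ} (hν : ∀ x, 0 < ν x) (f : Cfg σ n → ℝ) :
    0 ≤ dirichlet ν f :=
  Finset.sum_nonneg fun _ _ => innerW_self_nonneg hν _

/-- The commutator of `L_j` and the generator. -/
def commut (ν : Cfg σ n → ℝ) (j : Fin n) (f : Cfg σ n → ℝ) : Cfg σ n → ℝ :=
  LopLin ν j (genLin ν f) - genLin ν (LopLin ν j f)

lemma commut_eq_sum {ν : Cfg σ n → ℝ} {G : SimpleGraph (Fin n)} (hG : IsMRF ν G) (j : Fin n)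
    (f : Cfg σ n → ℝ) :
    commut ν j f = ∑ i ∈ Finset.univ.filter (fun i => G.Adj j i),
      (LopLin ν j (LopLin ν i f) - LopLin ν i (LopLin ν j f)) := by
  simp only [commut, genLin, LinearMap.sum_apply, map_sum]
  rw [← Finset.sum_sub_distrib, Finset.sum_filter]
  refine Finset.sum_congr rfl fun i _ => ?_
  split_ifs with h
  · rfl
  · have := PopLin_comm hG h f
    simp only [LopLin, LinearMap.sub_apply, LinearMap.id_apply, map_sub, this]
    abel

lemma sum_commut_le {ν : Cfg σ n → ℝ} (hν : ∀ x, 0 < ν x) {G : SimpleGraph (Fin n)}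
    (hG : IsMRF ν G) {Δ : ℕ} (hΔ : MaxDegLE G Δ) (f : Cfg σ n → ℝ) :
    ∑ j, innerW ν (commut ν j f) (commut ν j f) ≤ 4 * (Δ : ℝ) ^ 2 * dirichlet ν f := by
  set a : Fin n → ℝ := fun i => innerW ν (LopLin ν i f) (LopLin ν i f) with ha
  have ha0 : ∀ i, 0 ≤ a i := fun i => innerW_self_nonneg hν _
  have hdeg : ∀ i, ((Finset.univ.filter fun j => G.Adj i j).card : ℝ) ≤ Δ :=
    fun i => by exact_mod_cast hΔ i
  have h1 : ∀ j, innerW ν (commut ν j f) (commut ν j f) ≤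
      Δ * ∑ i ∈ Finset.univ.filter (fun i => G.Adj j i), (2 * a i + 2 * a j) := by
    intro j
    rw [commut_eq_sum hG]
    refine (innerW_sum_self_le hν _ _).trans ?_
    refine mul_le_mul (hdeg j) (Finset.sum_le_sum fun i _ => ?_)
      (Finset.sum_nonneg fun i _ => innerW_self_nonneg hν _) (Nat.cast_nonneg _)
    refine (innerW_sub_self_le hν _ _).trans ?_
    have := innerW_LopLin_le hν j (LopLin ν i f)
    have := innerW_LopLin_le hν i (LopLin ν j f)
    simp only [ha]
    linarith
  have h2 : ∑ j, ∑ i ∈ Finset.univ.filter (fun i => G.Adj j i), a j ≤ Δ * ∑ j, a j := by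
    rw [Finset.mul_sum]
    refine Finset.sum_le_sum fun j _ => ?_
    rw [Finset.sum_const, nsmul_eq_mul]
    exact mul_le_mul_of_nonneg_right (hdeg j) (ha0 j)
  have h3 : ∑ j, ∑ i ∈ Finset.univ.filter (fun i => G.Adj j i), a i =
      ∑ j, ∑ i ∈ Finset.univ.filter (fun i => G.Adj j i), a j := by
    simp only [Finset.sum_filter]
    rw [Finset.sum_comm]
    simp only [G.adj_comm]
  calc ∑ j, innerW ν (commut ν j f) (commut ν j f)
      ≤ ∑ j, (Δ : ℝ) * ∑ i ∈ Finset.univ.filter (fun i => G.Adj j i), (2 * a i + 2 * a j) :=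
        Finset.sum_le_sum fun j _ => h1 j
    _ = Δ * (4 * ∑ j, ∑ i ∈ Finset.univ.filter (fun i => G.Adj j i), a j) := by
        simp only [Finset.sum_add_distrib, ← Finset.mul_sum]
        rw [h3]
        ring
    _ ≤ Δ * (4 * (Δ * ∑ j, a j)) := by gcongr
    _ = 4 * (Δ : ℝ) ^ 2 * dirichlet ν f := by
        simp only [dirichlet, ha]
        ring

/-- The positive part `∑ i, Pop ν i` of the generator, as a continuous linear map. -/
def sumPop (ν : Cfg σ n → ℝ) : (Cfg σ n → ℝ) →L[ℝ] (Cfg σ n → ℝ) :=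
  LinearMap.toContinuousLinearMap (∑ i, PopLin ν i)

lemma genLin_eq (ν f : Cfg σ n → ℝ) : genLin ν f = sumPop ν f - (n : ℝ) • f := by
  simp [genLin, sumPop, LopLin, LinearMap.sum_apply, Finset.sum_sub_distrib, Nat.cast_smul_eq_nsmul]

/-- The Glauber semigroup `exp (t L)`, written as `exp (-n t) exp (t ∑ i, P_i)`. -/
def semigroup (ν : Cfg σ n → ℝ) (t : ℝ) (f : Cfg σ n → ℝ) : Cfg σ n → ℝ :=
  Real.exp (-(n * t)) • (NormedSpace.exp (t • sumPop ν)) f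

lemma semigroup_zero (ν f : Cfg σ n → ℝ) : semigroup ν 0 f = f := by
  simp [semigroup]

lemma hasDerivAt_exp_neg_mul (c t : ℝ) :
    HasDerivAt (fun s : ℝ => Real.exp (-(c * s))) (Real.exp (-(c * t)) * (-c)) t := by
  have h : HasDerivAt (fun s : ℝ => -(c * s)) (-(c * 1)) t :=
    ((hasDerivAt_id t).const_mul c).fun_neg
  rw [mul_one] at h
  exact h.exp

lemma hasDerivAt_semigroup (ν f : Cfg σ n → ℝ) (t : ℝ) :
    HasDerivAt (fun s => semigroup ν s f) (genLin ν (semigroup ν t f)) t := by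
  have h1 : HasDerivAt (fun s => (NormedSpace.exp (s • sumPop ν)) f)
      ((sumPop ν * NormedSpace.exp (t • sumPop ν)) f) t :=
    ((ContinuousLinearMap.apply ℝ (Cfg σ n → ℝ) f).hasFDerivAt).comp_hasDerivAt t
      (hasDerivAt_exp_smul_const' (𝕂 := ℝ) (sumPop ν) t)
  refine ((hasDerivAt_exp_neg_mul (n : ℝ) t).smul h1).congr_deriv ?_
  rw [genLin_eq]
  simp only [semigroup, map_smul, mul_apply_eq_comp, smul_smul]
  rw [mul_neg, neg_smul, ← sub_eq_add_neg, mul_comm (Real.exp _) (n : ℝ)]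

lemma hasDerivAt_semigroup_apply (ν f : Cfg σ n → ℝ) (t : ℝ) (x : Cfg σ n) :
    HasDerivAt (fun s => semigroup ν s f x) (genLin ν (semigroup ν t f) x) t :=
  hasDerivAt_pi.1 (hasDerivAt_semigroup ν f t) x

lemma sumPop_pow_nonneg {ν : Cfg σ n → ℝ} (hν : ∀ x, 0 < ν x) {f : Cfg σ n → ℝ}
    (hf : ∀ x, 0 ≤ f x) (k : ℕ) (x : Cfg σ n) : 0 ≤ (sumPop ν ^ k) f x := by
  induction k generalizing x with
  | zero => simpa using hf x
  | succ k ih =>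
    rw [pow_succ', mul_apply_eq_comp]
    simp only [sumPop, LinearMap.coe_toContinuousLinearMap', LinearMap.sum_apply,
      Finset.sum_apply, PopLin_apply, Pop_eq_sum_kern] at ih ⊢
    exact Finset.sum_nonneg fun i _ => Finset.sum_nonneg fun y _ =>
      mul_nonneg (kern_nonneg hν i x y) (ih y)

lemma hasSum_exp_apply (A : (Cfg σ n → ℝ) →L[ℝ] (Cfg σ n → ℝ)) (t : ℝ) (f : Cfg σ n → ℝ)
    (x : Cfg σ n) :
    HasSum (fun k : ℕ => ((k.factorial : ℝ))⁻¹ * (t ^ k * (A ^ k) f x))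
      (NormedSpace.exp (t • A) f x) := by
  have h := NormedSpace.exp_series_hasSum_exp' (𝕂 := ℝ) (t • A)
  have h2 := (h.mapL (ContinuousLinearMap.apply ℝ (Cfg σ n → ℝ) f)).mapL
    (ContinuousLinearMap.proj (R := ℝ) (φ := fun _ : Cfg σ n => ℝ) x)
  simpa [smul_pow] using h2

lemma le_semigroup {ν : Cfg σ n → ℝ} (hν : ∀ x, 0 < ν x) {f : Cfg σ n → ℝ}
    (hf : ∀ x, 0 ≤ f x) {t : ℝ} (ht : 0 ≤ t) (x : Cfg σ n) :
    Real.exp (-(n * t)) * f x ≤ semigroup ν t f x := by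
  have h := hasSum_exp_apply (sumPop ν) t f x
  have h0 := le_hasSum h 0 fun k _ => mul_nonneg (by positivity)
    (mul_nonneg (pow_nonneg ht k) (sumPop_pow_nonneg hν hf k x))
  simp only [Nat.factorial_zero, Nat.cast_one, inv_one, pow_zero, one_mul,
    one_apply_eq_self] at h0
  exact mul_le_mul_of_nonneg_left h0 (Real.exp_pos _).le

lemma semigroup_sub (ν f g : Cfg σ n → ℝ) (t : ℝ) :
    semigroup ν t (f - g) = semigroup ν t f - semigroup ν t g := by
  simp [semigroup, smul_sub]

lemma semigroup_mono {ν : Cfg σ n → ℝ} (hν : ∀ x, 0 < ν x) {f g : Cfg σ n → ℝ}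
    (hfg : ∀ x, f x ≤ g x) {t : ℝ} (ht : 0 ≤ t) (x : Cfg σ n) :
    semigroup ν t f x ≤ semigroup ν t g x := by
  have h := le_semigroup hν (f := g - f) (fun x => sub_nonneg.2 (hfg x)) ht x
  rw [semigroup_sub] at h
  have h2 : 0 ≤ Real.exp (-(n * t)) * (g - f) x :=
    mul_nonneg (Real.exp_pos _).le (sub_nonneg.2 (hfg x))
  exact sub_nonneg.1 (h2.trans h)

lemma semigroup_neg (ν f : Cfg σ n → ℝ) (t : ℝ) :
    semigroup ν t (-f) = -semigroup ν t f := by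
  simp [semigroup]

lemma abs_semigroup_le {ν : Cfg σ n → ℝ} (hν : ∀ x, 0 < ν x) {f g : Cfg σ n → ℝ}
    (hfg : ∀ x, |f x| ≤ g x) {t : ℝ} (ht : 0 ≤ t) (x : Cfg σ n) :
    |semigroup ν t f x| ≤ semigroup ν t g x := by
  rw [abs_le']
  refine ⟨semigroup_mono hν (fun x => (le_abs_self _).trans (hfg x)) ht x, ?_⟩
  have := semigroup_mono hν (f := -f) (g := g) (fun x => (neg_le_abs _).trans (hfg x)) ht x
  rwa [semigroup_neg] at this

lemma hasDerivAt_innerW (ν : Cfg σ n → ℝ) {f g : ℝ → Cfg σ n → ℝ} {f' g' : Cfg σ n → ℝ} {t : ℝ}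
    (hf : HasDerivAt f f' t) (hg : HasDerivAt g g' t) :
    HasDerivAt (fun s => innerW ν (f s) (g s)) (innerW ν f' (g t) + innerW ν (f t) g') t := by
  have h : HasDerivAt (fun s => ∑ x, ν x * (f s x * g s x))
      (∑ x, ν x * (f' x * g t x + f t x * g' x)) t :=
    HasDerivAt.fun_sum fun x _ =>
      ((hasDerivAt_pi.1 hf x).mul (hasDerivAt_pi.1 hg x)).const_mul (ν x)
  refine h.congr_deriv ?_
  simp only [innerW, mul_add, Finset.sum_add_distrib]

lemma hasDerivAt_innerW_self (ν : Cfg σ n → ℝ) {f : ℝ → Cfg σ n → ℝ} {f' : Cfg σ n → ℝ} {t : ℝ}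
    (hf : HasDerivAt f f' t) :
    HasDerivAt (fun s => innerW ν (f s) (f s)) (2 * innerW ν (f t) f') t := by
  refine (hasDerivAt_innerW ν hf hf).congr_deriv ?_
  rw [innerW_comm ν f']
  ring

lemma hasDerivAt_linearMap_comp (A : (Cfg σ n → ℝ) →ₗ[ℝ] (Cfg σ n → ℝ))
    {f : ℝ → Cfg σ n → ℝ} {f' : Cfg σ n → ℝ} {t : ℝ} (hf : HasDerivAt f f' t) :
    HasDerivAt (fun s => A (f s)) (A f') t :=
  (LinearMap.toContinuousLinearMap A).hasFDerivAt.comp_hasDerivAt t hf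

lemma continuous_semigroup (ν f : Cfg σ n → ℝ) : Continuous fun t => semigroup ν t f :=
  continuous_iff_continuousAt.2 fun t => (hasDerivAt_semigroup ν f t).continuousAt

lemma continuous_innerW_self (ν : Cfg σ n → ℝ) {f : ℝ → Cfg σ n → ℝ} (hf : Continuous f) :
    Continuous fun s => innerW ν (f s) (f s) := by
  unfold innerW
  fun_prop

lemma continuous_dirichlet_semigroup (ν f : Cfg σ n → ℝ) :
    Continuous fun t => dirichlet ν (semigroup ν t f) :=
  continuous_finsetSum _ fun j _ => continuous_innerW_self ν
    ((LinearMap.continuous_of_finiteDimensional (LopLin ν j)).comp (continuous_semigroup ν f))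

/-- The defect of commutation between `L_j` and the semigroup. -/
def defect (ν : Cfg σ n → ℝ) (f : Cfg σ n → ℝ) (j : Fin n) (t : ℝ) : Cfg σ n → ℝ :=
  LopLin ν j (semigroup ν t f) - semigroup ν t (LopLin ν j f)

lemma hasDerivAt_defect (ν f : Cfg σ n → ℝ) (j : Fin n) (t : ℝ) :
    HasDerivAt (defect ν f j)
      (genLin ν (defect ν f j t) + commut ν j (semigroup ν t f)) t := by
  refine ((hasDerivAt_linearMap_comp (LopLin ν j) (hasDerivAt_semigroup ν f t)).sub
    (hasDerivAt_semigroup ν (LopLin ν j f) t)).congr_deriv ?_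
  simp only [defect, commut, map_sub]
  abel

/-- Grönwall-type bound: in mean square over `[0, T]`, the Dirichlet form along the semigroup is
controlled by the semigroup applied to the increments `L_j f`. -/
lemma integral_dirichlet_semigroup_le {ν : Cfg σ n → ℝ} (hν : ∀ x, 0 < ν x)
    {G : SimpleGraph (Fin n)} (hG : IsMRF ν G) {Δ : ℕ} (hΔ : MaxDegLE G Δ) (hΔ0 : 0 < Δ)
    (f : Cfg σ n → ℝ) {T : ℝ} (hT : 0 < T) (hTΔ : Δ * T ≤ 1 / 6) {K : ℝ → ℝ} (hK : Continuous K)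
    (hK0 : ∀ t, 0 ≤ K t)
    (hHK : ∀ t, 0 ≤ t →
      ∑ j, innerW ν (semigroup ν t (LopLin ν j f)) (semigroup ν t (LopLin ν j f)) ≤ K t) :
    ∫ t in (0:ℝ)..T, dirichlet ν (semigroup ν t f) ≤ 5 * ∫ t in (0:ℝ)..T, K t := by
  set D : ℝ := (Δ : ℝ) with hD
  have hDpos : 0 < D := by rw [hD]; exact_mod_cast hΔ0
  set E : ℝ → ℝ := fun t => ∑ j, innerW ν (defect ν f j t) (defect ν f j t) with hE
  set A : ℝ → ℝ := fun t => dirichlet ν (semigroup ν t f) with hA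
  set I : ℝ → ℝ := fun t => ∫ s in (0:ℝ)..t, K s with hI
  have hAE : ∀ t, 0 ≤ t → A t ≤ 2 * E t + 2 * K t := by
    intro t ht
    have h : A t ≤ 2 * E t + 2 * ∑ j, innerW ν (semigroup ν t (LopLin ν j f))
        (semigroup ν t (LopLin ν j f)) := by
      simp only [hA, hE, dirichlet, Finset.mul_sum]
      rw [← Finset.sum_add_distrib]
      refine Finset.sum_le_sum fun j _ => ?_
      have h1 := innerW_sub_self_le hν (defect ν f j t) (-semigroup ν t (LopLin ν j f))
      have h2 : defect ν f j t - -semigroup ν t (LopLin ν j f) = LopLin ν j (semigroup ν t f) := by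
        simp [defect]
      rwa [h2, innerW_neg_right, innerW_comm ν (-semigroup ν t _), innerW_neg_right, neg_neg] at h1
    linarith [hHK t ht]
  set E' : ℝ → ℝ := fun t => ∑ j, 2 * innerW ν (defect ν f j t)
    (genLin ν (defect ν f j t) + commut ν j (semigroup ν t f)) with hE'
  have hEderiv : ∀ t, HasDerivAt E (E' t) t := fun t =>
    HasDerivAt.fun_sum fun j _ => hasDerivAt_innerW_self ν (hasDerivAt_defect ν f j t)
  have hEle : ∀ t, 0 ≤ t → E' t ≤ 6 * D * E t + 3 * D * K t := by
    intro t ht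
    have h1 : E' t ≤ ∑ j, (3 * D * innerW ν (defect ν f j t) (defect ν f j t) + (3 * D)⁻¹ *
        innerW ν (commut ν j (semigroup ν t f)) (commut ν j (semigroup ν t f))) := by
      refine Finset.sum_le_sum fun j _ => ?_
      have h1 := innerW_le_young hν (κ := 3 * D) (by positivity) (defect ν f j t)
        (commut ν j (semigroup ν t f))
      rw [innerW_add_right, innerW_genLin_self hν]
      have h2 := dirichlet_nonneg hν (defect ν f j t)
      linarith
    rw [Finset.sum_add_distrib, ← Finset.mul_sum, ← Finset.mul_sum] at h1
    have h2 := sum_commut_le hν hG hΔ (semigroup ν t f)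
    have h3 : (3 * D)⁻¹ * ∑ j, innerW ν (commut ν j (semigroup ν t f))
        (commut ν j (semigroup ν t f)) ≤ (3 * D)⁻¹ * (4 * D ^ 2 * A t) := by gcongr
    have h4 : (3 * D)⁻¹ * (4 * D ^ 2 * A t) = 4 / 3 * D * A t := by field_simp
    have h5 := mul_le_mul_of_nonneg_left (hAE t ht) hDpos.le
    have h6 : 0 ≤ D * E t :=
      mul_nonneg hDpos.le (Finset.sum_nonneg fun j _ => innerW_self_nonneg hν _)
    have h7 : 0 ≤ D * K t := mul_nonneg hDpos.le (hK0 t)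
    simp only [hE] at h5 h6 ⊢
    linarith
  have hIderiv : ∀ t, HasDerivAt I (K t) t := fun t =>
    (hK.integral_hasStrictDerivAt 0 t).hasDerivAt
  have hI0 : I 0 = 0 := by simp [hI]
  have hE0 : E 0 = 0 := by
    simp [hE, defect, semigroup_zero, innerW]
  have hexp : ∀ t : ℝ, HasDerivAt (fun s : ℝ => Real.exp (-(6 * D * s)))
      (Real.exp (-(6 * D * t)) * (-(6 * D))) t := hasDerivAt_exp_neg_mul (6 * D)
  have hφ : ∀ t, HasDerivAt (fun s => Real.exp (-(6 * D * s)) * E s - 3 * D * I s)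
      (Real.exp (-(6 * D * t)) * (-(6 * D)) * E t + Real.exp (-(6 * D * t)) * E' t
        - 3 * D * K t) t :=
    fun t => ((hexp t).mul (hEderiv t)).sub ((hIderiv t).const_mul (3 * D))
  have hanti : AntitoneOn (fun s => Real.exp (-(6 * D * s)) * E s - 3 * D * I s) (Set.Ici 0) := by
    refine antitoneOn_of_deriv_nonpos (convex_Ici 0)
      (fun t _ => (hφ t).continuousAt.continuousWithinAt)
      (fun t _ => (hφ t).differentiableAt.differentiableWithinAt) fun t ht => ?_
    rw [interior_Ici] at ht
    have ht0 : 0 ≤ t := le_of_lt ht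
    rw [(hφ t).deriv]
    have h1 := mul_le_mul_of_nonneg_left (hEle t ht0) (Real.exp_pos (-(6 * D * t))).le
    have h2 : Real.exp (-(6 * D * t)) ≤ 1 := Real.exp_le_one_iff.2 (by
      have := mul_nonneg hDpos.le ht0; linarith)
    have h3 := mul_le_mul_of_nonneg_right h2 (mul_nonneg hDpos.le (hK0 t))
    linarith
  have hIT : ∀ t, t ∈ Set.Icc 0 T → I t ≤ I T := by
    intro t ht
    have := intervalIntegral.integral_add_adjacent_intervals
      (hK.intervalIntegrable 0 t) (hK.intervalIntegrable t T) (μ := MeasureTheory.volume)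
    have h2 : 0 ≤ ∫ s in t..T, K s :=
      intervalIntegral.integral_nonneg ht.2 fun s _ => hK0 s
    simp only [hI]
    linarith
  have hEbound : ∀ t, t ∈ Set.Icc 0 T → E t ≤ 3 * (3 * D * I T) := by
    intro t ht
    have h1 := hanti (Set.mem_Ici.2 le_rfl) (Set.mem_Ici.2 ht.1) ht.1
    simp only [hI0, hE0, mul_zero, sub_zero] at h1
    have h2 : Real.exp (6 * D * t) ≤ 3 := by
      have : 6 * D * t ≤ 1 := by
        have := mul_le_mul_of_nonneg_left ht.2 hDpos.le
        linarith
      exact (Real.exp_le_exp.2 this).trans (Real.exp_one_lt_d9.le.trans (by norm_num))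
    have h3 : E t = Real.exp (6 * D * t) * (Real.exp (-(6 * D * t)) * E t) := by
      rw [← mul_assoc, ← Real.exp_add]; simp
    have h4 : 0 ≤ I T := intervalIntegral.integral_nonneg hT.le fun s _ => hK0 s
    have h5 := hIT t ht
    rw [h3]
    have h6 : Real.exp (-(6 * D * t)) * E t ≤ 3 * D * I T := by
      have := mul_le_mul_of_nonneg_left h5 hDpos.le
      linarith
    calc _ ≤ Real.exp (6 * D * t) * (3 * D * I T) := by gcongr
      _ ≤ 3 * (3 * D * I T) := by gcongr
  have hAc : Continuous A := continuous_dirichlet_semigroup ν f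
  have hmono : ∫ t in (0:ℝ)..T, A t ≤ ∫ t in (0:ℝ)..T, (2 * (3 * (3 * D * I T)) + 2 * K t) := by
    refine intervalIntegral.integral_mono_on hT.le (hAc.intervalIntegrable _ _)
      (Continuous.intervalIntegrable (by fun_prop) _ _) fun t ht => ?_
    linarith [hAE t ht.1, hEbound t ht]
  refine hmono.trans ?_
  rw [intervalIntegral.integral_add (by simp) (Continuous.intervalIntegrable (by fun_prop) _ _),
    intervalIntegral.integral_const, intervalIntegral.integral_const_mul]
  have h4 : 0 ≤ I T := intervalIntegral.integral_nonneg hT.le fun s _ => hK0 s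
  have h5 := mul_le_mul_of_nonneg_right hTΔ h4
  simp only [smul_eq_mul, sub_zero]
  change T * (2 * (3 * (3 * D * I T))) + 2 * I T ≤ 5 * I T
  linarith

lemma convexOn_sinh : ConvexOn ℝ (Set.Ici 0) Real.sinh := by
  refine convexOn_of_deriv2_nonneg (convex_Ici 0) Real.continuous_sinh.continuousOn
    Real.differentiable_sinh.differentiableOn ?_ fun x hx => ?_
  · rw [Real.deriv_sinh]
    exact Real.differentiable_cosh.differentiableOn
  · rw [interior_Ici] at hx
    simp only [Function.iterate_succ, Function.iterate_zero, Function.comp_apply, id_eq,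
      Real.deriv_sinh, Real.deriv_cosh]
    exact Real.sinh_nonneg_iff.2 (le_of_lt hx)

lemma sinh_mul_le {r w : ℝ} (hr0 : 0 ≤ r) (hr1 : r ≤ 1) (hw : 0 ≤ w) :
    Real.sinh (r * w) ≤ r * Real.sinh w := by
  have h := convexOn_sinh.2 (Set.mem_Ici.2 le_rfl) (Set.mem_Ici.2 hw) (sub_nonneg.2 hr1) hr0
    (by ring)
  simpa using h

lemma sinh_mul_sq_le {r : ℝ} (hr0 : 0 ≤ r) (hr1 : r ≤ 1) (w : ℝ) :
    Real.sinh (r * w) ^ 2 ≤ r ^ 2 * Real.sinh w ^ 2 := by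
  wlog hw : 0 ≤ w generalizing w
  · have := this (-w) (by linarith)
    simpa using this
  · rw [← mul_pow]
    exact pow_le_pow_left₀ (Real.sinh_nonneg_iff.2 (mul_nonneg hr0 hw)) (sinh_mul_le hr0 hr1 hw) 2

/-- The elementary inequality behind the Stroock–Varopoulos inequality, in exponential
coordinates. -/
lemma exp_sub_sq_le {p : ℝ} (hp1 : 1 < p) (hp2 : p ≤ 2) (x y : ℝ) :
    4 * (p - 1) / p ^ 2 * (Real.exp (p / 2 * x) - Real.exp (p / 2 * y)) ^ 2 ≤
      (Real.exp ((p - 1) * x) - Real.exp ((p - 1) * y)) * (Real.exp x - Real.exp y) := by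
  have hp0 : 0 < p := by linarith
  set w := p / 4 * (x - y) with hw
  set r := (2 - p) / p with hr
  have hr0 : 0 ≤ r := div_nonneg (by linarith) hp0.le
  have hr1 : r ≤ 1 := (div_le_one hp0).2 (by linarith)
  have hrw : r * w = (2 - p) / 4 * (x - y) := by
    rw [hr, hw]; field_simp
  have hcoef : 4 * (p - 1) / p ^ 2 = 1 - r ^ 2 := by
    rw [hr]; field_simp; ring
  have key := sinh_mul_sq_le hr0 hr1 w
  set m := Real.exp (p / 2 * (x + y)) with hm
  have e1 : (Real.exp (p / 2 * x) - Real.exp (p / 2 * y)) ^ 2 = m * (4 * Real.sinh w ^ 2) := by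
    have a1 : Real.exp (p / 2 * x) = Real.exp (p / 4 * (x + y)) * Real.exp w := by
      rw [← Real.exp_add, hw]; ring_nf
    have a2 : Real.exp (p / 2 * y) = Real.exp (p / 4 * (x + y)) * Real.exp (-w) := by
      rw [← Real.exp_add, hw]; ring_nf
    have a3 : m = Real.exp (p / 4 * (x + y)) ^ 2 := by
      rw [← Real.exp_nat_mul, hm]; congr 1; push_cast; ring
    rw [a1, a2, a3, Real.sinh_eq]
    ring
  have e2 : (Real.exp ((p - 1) * x) - Real.exp ((p - 1) * y)) * (Real.exp x - Real.exp y) =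
      m * (4 * (Real.sinh w ^ 2 - Real.sinh (r * w) ^ 2)) := by
    have b1 : Real.exp ((p - 1) * x) * Real.exp x = m * Real.exp w ^ 2 := by
      rw [← Real.exp_nat_mul, hm, ← Real.exp_add, ← Real.exp_add, hw]; congr 1; push_cast; ring
    have b2 : Real.exp ((p - 1) * y) * Real.exp y = m * Real.exp (-w) ^ 2 := by
      rw [← Real.exp_nat_mul, hm, ← Real.exp_add, ← Real.exp_add, hw]; congr 1; push_cast; ring
    have b3 : Real.exp ((p - 1) * x) * Real.exp y = m * Real.exp (-(r * w)) ^ 2 := by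
      rw [← Real.exp_nat_mul, hm, ← Real.exp_add, ← Real.exp_add, hrw]; congr 1; push_cast; ring
    have b4 : Real.exp ((p - 1) * y) * Real.exp x = m * Real.exp (r * w) ^ 2 := by
      rw [← Real.exp_nat_mul, hm, ← Real.exp_add, ← Real.exp_add, hrw]; congr 1; push_cast; ring
    have c1 : Real.exp w * Real.exp (-w) = 1 := by rw [← Real.exp_add]; simp
    have c2 : Real.exp (r * w) * Real.exp (-(r * w)) = 1 := by rw [← Real.exp_add]; simp
    rw [Real.sinh_eq, Real.sinh_eq]
    linear_combination b1 + b2 - b3 - b4 - 2 * m * c2 + 2 * m * c1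
  rw [hcoef, e1, e2]
  have h := mul_le_mul_of_nonneg_left key (Real.exp_pos (p / 2 * (x + y))).le
  rw [← hm] at h
  linarith

lemma rpow_sub_sq_le {p : ℝ} (hp1 : 1 < p) (hp2 : p ≤ 2) {a b : ℝ} (ha : 0 < a) (hb : 0 < b) :
    4 * (p - 1) / p ^ 2 * (a ^ (p / 2) - b ^ (p / 2)) ^ 2 ≤
      (a ^ (p - 1) - b ^ (p - 1)) * (a - b) := by
  have h := exp_sub_sq_le hp1 hp2 (Real.log a) (Real.log b)
  rw [Real.exp_log ha, Real.exp_log hb] at h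
  simpa only [Real.rpow_def_of_pos ha, Real.rpow_def_of_pos hb, mul_comm (Real.log _)] using h

/-- The Stroock–Varopoulos inequality. -/
lemma stroock_varopoulos {ν : Cfg σ n → ℝ} (hν : ∀ x, 0 < ν x) {p : ℝ} (hp1 : 1 < p)
    (hp2 : p ≤ 2) {u : Cfg σ n → ℝ} (hu : ∀ x, 0 < u x) :
    innerW ν (fun x => u x ^ (p - 1)) (genLin ν u) ≤
      -(4 * (p - 1) / p ^ 2 * dirichlet ν (fun x => u x ^ (p / 2))) := by
  simp only [genLin, LinearMap.sum_apply, innerW_sum_right, dirichlet, Finset.mul_sum,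
    ← Finset.sum_neg_distrib]
  refine Finset.sum_le_sum fun i _ => ?_
  rw [innerW_LopLin_self hν, innerW_LopLin hν, innerW_LopLin hν]
  have h : 4 * (p - 1) / p ^ 2 * ∑ x, ∑ y, ν x * kern ν i x y *
        ((u x ^ (p / 2) - u y ^ (p / 2)) * (u x ^ (p / 2) - u y ^ (p / 2))) ≤
      ∑ x, ∑ y, ν x * kern ν i x y * ((u x ^ (p - 1) - u y ^ (p - 1)) * (u x - u y)) := by
    simp only [Finset.mul_sum]
    refine Finset.sum_le_sum fun x _ => Finset.sum_le_sum fun y _ => ?_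
    have := mul_le_mul_of_nonneg_left (rpow_sub_sq_le hp1 hp2 (hu x) (hu y))
      (mul_nonneg (hν x).le (kern_nonneg hν i x y))
    linarith
  linarith

lemma LogSobolev.ent_le {ν : Cfg σ n → ℝ} {ρ : ℝ} (h : LogSobolev ν ρ) {g : Cfg σ n → ℝ}
    (hg : ∀ x, 0 ≤ g x) :
    ρ * entFun ν (fun x => g x ^ 2) ≤ 2 * dirichlet ν g := by
  have h1 := h (fun x => g x ^ 2) fun x => sq_nonneg _
  simp only [Real.sqrt_sq (hg _)] at h1
  simpa only [dirichlet, innerW, expct, LopLin_apply, pow_two] using h1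

lemma sq_mul_log_sq_ge {a m : ℝ} (ha : 0 ≤ a) (hm : 0 < m) :
    a ^ 2 * Real.log (m ^ 2) + 2 * a ^ 2 - 2 * m * a ≤ a ^ 2 * Real.log (a ^ 2) := by
  rcases ha.eq_or_lt with rfl | ha
  · simp
  · have h := Real.log_le_sub_one_of_pos (div_pos hm ha)
    rw [Real.log_div hm.ne' ha.ne'] at h
    rw [Real.log_pow, Real.log_pow]
    have h2 := mul_le_mul_of_nonneg_left h (sq_nonneg a)
    have h3 : a ^ 2 * (m / a - 1) = m * a - a ^ 2 := by field_simp
    push_cast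
    linarith

lemma varnc_eq {ν : Cfg σ n → ℝ} (h1 : ∑ x, ν x = 1) (f : Cfg σ n → ℝ) :
    varnc ν f = innerW ν f f - expct ν f ^ 2 := by
  unfold varnc
  set m := expct ν f with hm
  have h : expct ν (fun x => (f x - m) ^ 2) =
      innerW ν f f - 2 * m * expct ν f + m ^ 2 * ∑ x, ν x := by
    simp only [expct, innerW, Finset.mul_sum, ← Finset.sum_sub_distrib, ← Finset.sum_add_distrib]
    exact Finset.sum_congr rfl fun x _ => by ring
  rw [h, h1, ← hm]
  ring

lemma varnc_le_entFun_sq {ν : Cfg σ n → ℝ} (hν : ∀ x, 0 < ν x) (h1 : ∑ x, ν x = 1)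
    {g : Cfg σ n → ℝ} (hg : ∀ x, 0 ≤ g x) :
    varnc ν g ≤ entFun ν (fun x => g x ^ 2) := by
  rw [varnc_eq h1]
  have hM : expct ν (fun x => g x ^ 2) = innerW ν g g :=
    Finset.sum_congr rfl fun x _ => by ring
  rcases (innerW_self_nonneg hν g).eq_or_lt with h0 | hpos
  · have hz : ∀ x, g x = 0 := by
      intro x
      have := (Finset.sum_eq_zero_iff_of_nonneg
        (fun x _ => mul_nonneg (hν x).le (mul_self_nonneg (g x)))).1 h0.symm x (Finset.mem_univ x)
      simpa [(hν x).ne'] using this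
    simp [entFun, expct, innerW, hz]
  · set M := innerW ν g g with hMdef
    set m := Real.sqrt M with hmdef
    have hm : 0 < m := Real.sqrt_pos.2 hpos
    have hmM : m ^ 2 = M := Real.sq_sqrt hpos.le
    have h2 : ∑ x, ν x * (g x ^ 2 * Real.log (m ^ 2) + 2 * g x ^ 2 - 2 * m * g x) ≤
        expct ν (fun x => g x ^ 2 * Real.log (g x ^ 2)) :=
      Finset.sum_le_sum fun x _ =>
        mul_le_mul_of_nonneg_left (sq_mul_log_sq_ge (hg x) hm) (hν x).le
    have h3 : ∑ x, ν x * (g x ^ 2 * Real.log (m ^ 2) + 2 * g x ^ 2 - 2 * m * g x) =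
        M * Real.log M + 2 * M - 2 * m * expct ν g := by
      rw [hmM]
      generalize Real.log M = l
      rw [← hM]
      simp only [expct, Finset.mul_sum, Finset.sum_mul, ← Finset.sum_sub_distrib,
        ← Finset.sum_add_distrib]
      exact Finset.sum_congr rfl fun x _ => by ring
    unfold entFun
    rw [hM]
    nlinarith [sq_nonneg (m - expct ν g)]

lemma LopLin_const {ν : Cfg σ n → ℝ} (hν : ∀ x, 0 < ν x) (i : Fin n) (c : ℝ) :
    LopLin ν i (fun _ => c) = 0 := by
  ext x
  rw [LopLin_apply, Lop, Pop_eq_sum_kern, ← Finset.sum_mul, sum_kern hν]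
  simp

/-- The Poincaré inequality implied by the log-Sobolev inequality. -/
lemma LogSobolev.poincare {ν : Cfg σ n → ℝ} (hν : ∀ x, 0 < ν x) (h1 : ∑ x, ν x = 1) {ρ : ℝ}
    (hρ : 0 ≤ ρ) (h : LogSobolev ν ρ) (f : Cfg σ n → ℝ) :
    ρ * varnc ν f ≤ 2 * dirichlet ν f := by
  set M := ∑ x, |f x| with hM
  have hg : ∀ x, 0 ≤ f x + M := fun x => by
    have := Finset.single_le_sum (fun y _ => abs_nonneg (f y)) (Finset.mem_univ x)
    linarith [neg_abs_le (f x)]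
  have hv : varnc ν (fun x => f x + M) = varnc ν f := by
    have : expct ν (fun x => f x + M) = expct ν f + M := by
      simp only [expct, mul_add, Finset.sum_add_distrib, ← Finset.sum_mul, h1, one_mul]
    simp only [varnc, this, add_sub_add_right_eq_sub]
  have hd : dirichlet ν (fun x => f x + M) = dirichlet ν f := by
    have : (fun x => f x + M) = f + fun _ => M := rfl
    simp only [dirichlet, this, map_add, LopLin_const hν, add_zero]
  rw [← hv, ← hd]
  exact (mul_le_mul_of_nonneg_left (varnc_le_entFun_sq hν h1 hg) hρ).trans (h.ent_le hg)

/-- The `L^p` norm of the semigroup is nonincreasing along the exponent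
`p(s) = 1 + exp (2ρ(s - t))`, for positive functions. -/
lemma hypercontractive_pos {ν : Cfg σ n → ℝ} (hν : ∀ x, 0 < ν x) [Nonempty (Cfg σ n)] {ρ : ℝ}
    (hρ : 0 < ρ) (h : LogSobolev ν ρ) {f : Cfg σ n → ℝ} (hf : ∀ x, 0 < f x) {t : ℝ} (ht : 0 ≤ t) :
    innerW ν (semigroup ν t f) (semigroup ν t f) ≤
      (pnorm ν (1 + Real.exp (-(2 * ρ * t))) f) ^ 2 := by
  set p : ℝ → ℝ := fun s => 1 + Real.exp (-(2 * ρ * (t - s))) with hp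
  set u : ℝ → Cfg σ n → ℝ := fun s => semigroup ν s f with hu
  have hupos : ∀ s, 0 ≤ s → ∀ x, 0 < u s x := fun s hs x =>
    (mul_pos (Real.exp_pos _) (hf x)).trans_le (le_semigroup hν (fun x => (hf x).le) hs x)
  have hp1 : ∀ s, 1 < p s := fun s => by
    have := Real.exp_pos (-(2 * ρ * (t - s)))
    simp only [hp]; linarith
  have hp2 : ∀ s, s ≤ t → p s ≤ 2 := fun s hs => by
    have : Real.exp (-(2 * ρ * (t - s))) ≤ 1 := Real.exp_le_one_iff.2 (by
      have := mul_nonneg hρ.le (sub_nonneg.2 hs); linarith)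
    simp only [hp]; linarith
  have hpd : ∀ s, HasDerivAt p (2 * ρ * (p s - 1)) s := by
    intro s
    have h1 := (hasDerivAt_exp_neg_mul (2 * ρ) (t - s)).comp s
      ((hasDerivAt_id s).const_sub t)
    refine (h1.const_add 1).congr_deriv ?_
    simp only [hp]
    ring
  set N : ℝ → ℝ := fun s => ∑ x, ν x * u s x ^ p s with hN
  have hNpos : ∀ s, 0 ≤ s → 0 < N s := fun s hs =>
    Finset.sum_pos (fun x _ => mul_pos (hν x) (Real.rpow_pos_of_pos (hupos s hs x) _))
      Finset.univ_nonempty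
  have hNd : ∀ s, 0 ≤ s → HasDerivAt N
      (p s * innerW ν (fun x => u s x ^ (p s - 1)) (genLin ν (u s)) +
        2 * ρ * (p s - 1) * ∑ x, ν x * (u s x ^ p s * Real.log (u s x))) s := by
    intro s hs
    have h1 : HasDerivAt N _ s := HasDerivAt.fun_sum fun x _ =>
      (((hasDerivAt_semigroup_apply ν f s x).rpow (hpd s) (hupos s hs x)).const_mul (ν x))
    refine h1.congr_deriv ?_
    simp only [innerW, Finset.mul_sum, ← Finset.sum_add_distrib]
    exact Finset.sum_congr rfl fun x _ => by ring
  have hNle : ∀ s, 0 ≤ s → s ≤ t →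
      (p s * innerW ν (fun x => u s x ^ (p s - 1)) (genLin ν (u s)) +
        2 * ρ * (p s - 1) * ∑ x, ν x * (u s x ^ p s * Real.log (u s x))) * p s ≤
      N s * Real.log (N s) * (2 * ρ * (p s - 1)) := by
    intro s hs hst
    have hp0 : 0 < p s := by linarith [hp1 s]
    have h1 := stroock_varopoulos hν (hp1 s) (hp2 s hst) (hupos s hs)
    have h2 := h.ent_le (g := fun x => u s x ^ (p s / 2))
      fun x => (Real.rpow_pos_of_pos (hupos s hs x) _).le
    have h3 : ∀ x, (u s x ^ (p s / 2)) ^ 2 = u s x ^ p s := fun x => by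
      rw [← Real.rpow_natCast, ← Real.rpow_mul (hupos s hs x).le]
      congr 1
      push_cast
      ring
    have h4 : entFun ν (fun x => u s x ^ p s) =
        p s * ∑ x, ν x * (u s x ^ p s * Real.log (u s x)) - N s * Real.log (N s) := by
      simp only [entFun, expct, hN, Finset.mul_sum]
      congr 1
      refine Finset.sum_congr rfl fun x _ => ?_
      rw [Real.log_rpow (hupos s hs x)]
      ring
    simp only [h3] at h2
    rw [h4] at h2
    set D := dirichlet ν (fun x => u s x ^ (p s / 2))
    set I := innerW ν (fun x => u s x ^ (p s - 1)) (genLin ν (u s))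
    have h5 := mul_le_mul_of_nonneg_left h1 (sq_nonneg (p s))
    have h6 : p s ^ 2 * -(4 * (p s - 1) / p s ^ 2 * D) = -(4 * (p s - 1) * D) := by field_simp
    have h7 := mul_le_mul_of_nonneg_left h2 (by linarith [hp1 s] : 0 ≤ 2 * (p s - 1))
    linarith
  have hΦd : ∀ s, 0 ≤ s → HasDerivAt (fun s => Real.log (N s) / p s) _ s := fun s hs =>
    ((hNd s hs).log (hNpos s hs).ne').div (hpd s) (by linarith [hp1 s] : p s ≠ 0)
  have hanti : AntitoneOn (fun s => Real.log (N s) / p s) (Set.Icc 0 t) := by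
    refine antitoneOn_of_deriv_nonpos (convex_Icc 0 t)
      (fun s hs => (hΦd s hs.1).continuousAt.continuousWithinAt)
      (fun s hs => (hΦd s (interior_subset hs).1).differentiableAt.differentiableWithinAt)
      fun s hs => ?_
    have hs' := interior_subset hs
    rw [(hΦd s hs'.1).deriv]
    refine div_nonpos_of_nonpos_of_nonneg (sub_nonpos.2 ?_) (sq_nonneg _)
    rw [div_mul_eq_mul_div, div_le_iff₀ (hNpos s hs'.1)]
    linarith [hNle s hs'.1 hs'.2]
  have h0t := hanti ⟨le_rfl, ht⟩ ⟨ht, le_rfl⟩ ht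
  have hpt : p t = 2 := by simp only [hp, sub_self, mul_zero, neg_zero, Real.exp_zero]; norm_num
  have hp0 : p 0 = 1 + Real.exp (-(2 * ρ * t)) := by simp only [hp, sub_zero]
  have hNt : N t = innerW ν (semigroup ν t f) (semigroup ν t f) := by
    simp only [hN, hpt, innerW, hu, Real.rpow_two, pow_two]
  have hN0 : pnorm ν (p 0) f = N 0 ^ (1 / p 0) := by
    simp only [pnorm, hN, hu, semigroup_zero, abs_of_pos (hf _)]
  rw [← hNt, ← hp0, hN0, Real.rpow_def_of_pos (hNpos 0 le_rfl), ← Real.exp_nat_mul,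
    ← Real.log_le_iff_le_exp (hNpos t ht)]
  simp only [hpt] at h0t
  push_cast
  rw [mul_one_div]
  linarith

/-- Hypercontractivity of the Glauber semigroup. -/
lemma hypercontractive {ν : Cfg σ n → ℝ} (hν : ∀ x, 0 < ν x) [Nonempty (Cfg σ n)] {ρ : ℝ}
    (hρ : 0 < ρ) (h : LogSobolev ν ρ) (f : Cfg σ n → ℝ) {t : ℝ} (ht : 0 ≤ t) :
    innerW ν (semigroup ν t f) (semigroup ν t f) ≤
      (pnorm ν (1 + Real.exp (-(2 * ρ * t))) f) ^ 2 := by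
  set p := 1 + Real.exp (-(2 * ρ * t)) with hp
  have hp0 : 0 ≤ p := by positivity
  have hc : Continuous fun ε : ℝ => (pnorm ν p (fun x => |f x| + ε)) ^ 2 := by
    unfold pnorm
    refine (Continuous.rpow_const (continuous_finsetSum _ fun x _ => ?_)
      fun _ => Or.inr (by positivity)).pow 2
    exact continuous_const.mul (Continuous.rpow_const (by fun_prop) fun _ => Or.inr hp0)
  have hlim := (hc.tendsto 0).mono_left (nhdsWithin_le_nhds (s := Set.Ioi 0))
  have h0 : pnorm ν p (fun x => |f x| + 0) = pnorm ν p f := by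
    simp [pnorm]
  rw [h0] at hlim
  refine ge_of_tendsto hlim ?_
  filter_upwards [self_mem_nhdsWithin] with ε hε
  have hε0 : 0 < ε := hε
  refine le_trans ?_ (hypercontractive_pos hν hρ h (f := fun x => |f x| + ε)
    (fun x => add_pos_of_nonneg_of_pos (abs_nonneg _) hε0) ht)
  refine Finset.sum_le_sum fun x _ => mul_le_mul_of_nonneg_left ?_ (hν x).le
  rw [← abs_mul_abs_self (semigroup ν t f x)]
  have := abs_semigroup_le hν (f := f) (g := fun x => |f x| + ε)
    (fun x => by linarith) ht x
  exact mul_self_le_mul_self (abs_nonneg _) this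

lemma hasDerivAt_varnc_semigroup {ν : Cfg σ n → ℝ} (hν : ∀ x, 0 < ν x) (h1 : ∑ x, ν x = 1)
    (f : Cfg σ n → ℝ) (t : ℝ) :
    HasDerivAt (fun s => varnc ν (semigroup ν s f)) (-(2 * dirichlet ν (semigroup ν t f))) t := by
  have hE : ∀ g, expct ν g = innerW ν (fun _ => 1) g := fun g => by
    simp only [expct, innerW, one_mul]
  have hz : ∀ g, innerW ν (fun _ => 1) (genLin ν g) = 0 := by
    intro g
    simp only [genLin, LinearMap.sum_apply, innerW_sum_right, LopLin_selfAdjoint hν,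
      LopLin_const hν]
    simp [innerW]
  have hexp : HasDerivAt (fun s => expct ν (semigroup ν s f)) 0 t := by
    have h := hasDerivAt_innerW ν (hasDerivAt_const t (fun _ : Cfg σ n => (1 : ℝ)))
      (hasDerivAt_semigroup ν f t)
    simp only [hE]
    refine h.congr_deriv ?_
    rw [hz]
    simp [innerW]
  simp only [varnc_eq h1]
  refine ((hasDerivAt_innerW_self ν (hasDerivAt_semigroup ν f t)).sub
    (hexp.pow 2)).congr_deriv ?_
  rw [innerW_genLin_self hν]
  ring

/-- Variance is bounded by the time integral of the Dirichlet form along the semigroup. -/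
lemma varnc_le_integral_dirichlet {ν : Cfg σ n → ℝ} (hν : ∀ x, 0 < ν x) (h1 : ∑ x, ν x = 1)
    {ρ : ℝ} (hρ : 0 ≤ ρ) (h : LogSobolev ν ρ) (f : Cfg σ n → ℝ) {T : ℝ} (hT : 0 ≤ T) :
    (1 - Real.exp (-(ρ * T))) * varnc ν f ≤
      2 * ∫ t in (0:ℝ)..T, dirichlet ν (semigroup ν t f) := by
  have hd := hasDerivAt_varnc_semigroup hν h1 f
  have hftc := intervalIntegral.integral_eq_sub_of_hasDerivAt (a := 0) (b := T)
    (fun t _ => hd t)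
    (((continuous_dirichlet_semigroup ν f).const_mul 2).neg.intervalIntegrable 0 T)
  rw [intervalIntegral.integral_neg, intervalIntegral.integral_const_mul, semigroup_zero] at hftc
  have hφ : ∀ t, HasDerivAt (fun s => Real.exp (-(-ρ * s)) * varnc ν (semigroup ν s f)) _ t :=
    fun t => (hasDerivAt_exp_neg_mul (-ρ) t).mul (hd t)
  have hanti : Antitone fun s => Real.exp (-(-ρ * s)) * varnc ν (semigroup ν s f) := by
    refine antitone_of_deriv_nonpos (fun t => (hφ t).differentiableAt) fun t => ?_
    rw [(hφ t).deriv]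
    have h2 := mul_le_mul_of_nonneg_left (h.poincare hν h1 hρ (semigroup ν t f))
      (Real.exp_pos (-(-ρ * t))).le
    linarith
  have h3 := hanti hT
  simp only [semigroup_zero, mul_zero, neg_zero, Real.exp_zero, one_mul] at h3
  have h4 := mul_le_mul_of_nonneg_left h3 (Real.exp_pos (-(ρ * T))).le
  rw [← mul_assoc, ← Real.exp_add] at h4
  have h5 : -(ρ * T) + -(-ρ * T) = 0 := by ring
  rw [h5, Real.exp_zero, one_mul] at h4
  linarith

/-- **Main functional inequality** (Theorem 3.1 of the paper).
There are absolute constants `c, c' > 0` such that for every `ν` satisfying Assumption A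
(with `q = |Σ|`), every `f : Σ^n → ℝ`, and every `T` with `0 < T ≤ c/(b²q²Δ²)`,
`Var_ν(f) ≤ (c' q² b²/(1 - e^{-ρT})) ∫₀^T ∑_j ‖L_j f‖²_{1+e^{-2ρt}} dt`. -/
theorem main_functional_inequality :
    ∃ c c' : ℝ, 0 < c ∧ 0 < c' ∧
      ∀ (n : ℕ) (σ : Type) [Fintype σ] [DecidableEq σ],
        ∀ (b ρ : ℝ) (Δ : ℕ) (ν : Cfg σ n → ℝ), AssumptionA ν b ρ Δ →
          ∀ f : Cfg σ n → ℝ, ∀ T : ℝ, 0 < T →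
            T ≤ c / (b ^ 2 * (Fintype.card σ : ℝ) ^ 2 * (Δ : ℝ) ^ 2) →
            varnc ν f ≤
              (c' * (Fintype.card σ : ℝ) ^ 2 * b ^ 2 / (1 - Real.exp (-(ρ * T)))) *
                ∫ t in (0:ℝ)..T,
                  ∑ j : Fin n, (pnorm ν (1 + Real.exp (-(2 * ρ * t))) (Lop ν j f)) ^ 2 := by
  refine ⟨1 / 6, 10, by norm_num, by norm_num, ?_⟩
  intro n σ _ _ b ρ Δ ν hA f T hT hTle
  obtain ⟨⟨hν, h1⟩, hb, -, hρ, -, hLS, G, hG, hΔ⟩ := hA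
  have hne : Nonempty (Cfg σ n) := by
    by_contra hne
    rw [not_nonempty_iff] at hne
    simp at h1
  set q : ℝ := (Fintype.card σ : ℝ) with hq
  have hq0 : Fintype.card σ ≠ 0 := fun h0 => by
    rw [hq, h0] at hTle
    simp at hTle
    linarith
  have hΔ0 : Δ ≠ 0 := fun h0 => by
    rw [h0] at hTle
    simp at hTle
    linarith
  have hq1 : 1 ≤ q := by rw [hq]; exact_mod_cast Nat.one_le_iff_ne_zero.2 hq0
  have hΔ1 : (1 : ℝ) ≤ Δ := by exact_mod_cast Nat.one_le_iff_ne_zero.2 hΔ0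
  have hqb : 1 ≤ q ^ 2 * b ^ 2 := one_le_mul_of_one_le_of_one_le (one_le_pow₀ hq1) (one_le_pow₀ hb)
  have hTΔ : Δ * T ≤ 1 / 6 := by
    rw [le_div_iff₀ (by positivity)] at hTle
    refine le_trans ?_ hTle
    rw [mul_comm (Δ : ℝ) T]
    refine mul_le_mul_of_nonneg_left ?_ hT.le
    calc (Δ : ℝ) ≤ Δ ^ 2 := le_self_pow₀ hΔ1 two_ne_zero
      _ ≤ b ^ 2 * q ^ 2 * Δ ^ 2 :=
        le_mul_of_one_le_left (by positivity) (by rwa [mul_comm])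
  set K : ℝ → ℝ := fun t =>
    ∑ j : Fin n, (pnorm ν (1 + Real.exp (-(2 * ρ * t))) (Lop ν j f)) ^ 2 with hKdef
  have hK : Continuous K := by
    refine continuous_finsetSum _ fun j _ => Continuous.pow ?_ 2
    have hp : Continuous fun t : ℝ => 1 + Real.exp (-(2 * ρ * t)) := by fun_prop
    have hpos : ∀ t : ℝ, 0 < 1 + Real.exp (-(2 * ρ * t)) := fun t => by positivity
    refine Continuous.rpow (continuous_finsetSum _ fun x _ => continuous_const.mul
      (continuous_const.rpow hp fun t => Or.inr (hpos t)))
      (continuous_const.div hp fun t => (hpos t).ne') fun t => Or.inr (one_div_pos.2 (hpos t))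
  have hK0 : ∀ t, 0 ≤ K t := fun t => Finset.sum_nonneg fun j _ => sq_nonneg _
  have h5 := integral_dirichlet_semigroup_le hν hG hΔ (Nat.pos_of_ne_zero hΔ0) f hT hTΔ hK hK0
    fun t ht => Finset.sum_le_sum fun j _ => hypercontractive hν hρ hLS _ ht
  have hI : 0 ≤ ∫ t in (0:ℝ)..T, K t := intervalIntegral.integral_nonneg hT.le fun t _ => hK0 t
  have h6 := varnc_le_integral_dirichlet hν h1 hρ.le hLS f hT.le
  have hden : 0 < 1 - Real.exp (-(ρ * T)) := by
    rw [sub_pos, Real.exp_lt_one_iff]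
    linarith [mul_pos hρ hT]
  rw [div_mul_eq_mul_div, le_div_iff₀ hden]
  have h7 := le_mul_of_one_le_left hI hqb
  linarith
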